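/- Let P_1, …, P_N be Markov kernels on a measurable space (X, ℬ), each leaving a probability measure π invariant, and suppose the systematic-scan kernel P_GS = P_1 P_2 ⋯ P_N is uniformly ergodic with invariant distribution π. Let ε > 0 and p ∈ [ε,1]^N with Σ_{i=1}^N p_i = 1. Then the single-coordinate random-scan kernel P_p := Σ_{i=1}^N p_i P_i is uniformly ergodic with invariant distribution π (the random-scan Gibbs sampler RSG(p) inherits uniform ergodicity from the systematic scan; this is the result used as assumption (b) of Proposition 3.2). -/

import Mathlib

open MeasureTheory ProbabilityTheory Filter
open scoped ENNReal

/-- Total variation distance between two measures: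
`‖μ − ν‖_TV = sup_{A ∈ ℬ} |μ(A) − ν(A)|`. -/
noncomputable def tvDist {X : Type*} [MeasurableSpace X] (μ ν : Measure X) : ℝ :=
  ⨆ A : {s : Set X // MeasurableSet s}, |(μ A.1).toReal - (ν A.1).toReal|

/-- `n`-fold composition of a kernel with itself (`kpow P 0` is the identity kernel).
Recall `η ∘ₖ κ` applies `κ` first and then `η`. -/
noncomputable def kpow {X : Type*} [MeasurableSpace X] (P : Kernel X X) : ℕ → Kernel X X
  | 0 => Kernel.id
  | n + 1 => kpow P n ∘ₖ P

/-- Composition of a list of kernels, applying them in the order of the list. -/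
noncomputable def seqComp {X : Type*} [MeasurableSpace X] (l : List (Kernel X X)) : Kernel X X :=
  l.foldl (fun acc κ => κ ∘ₖ acc) Kernel.id

/-- The composed kernel `P_S` for a subset `S ⊆ {1,…,N}`, applying the kernels of `S` in
increasing index order. -/
noncomputable def subsetComp {X : Type*} [MeasurableSpace X] {N : ℕ}
    (P : Fin N → Kernel X X) (S : Finset (Fin N)) : Kernel X X :=
  seqComp ((S.sort (· ≤ ·)).map P)

/-- The systematic-scan (Gibbs) kernel `P_GS = P_1 P_2 ⋯ P_N`. -/
noncomputable def gsKernel {X : Type*} [MeasurableSpace X] {N : ℕ}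
    (P : Fin N → Kernel X X) : Kernel X X :=
  subsetComp P Finset.univ

/-- Selection weight `w_S(q)` of a nonempty subset `S` in the multiple random-scan scheme:
`w_S(q) = (∏_{i∈S} q_i ∏_{i∉S} (1 − q_i)) / (1 − ∏_i (1 − q_i))`. -/
noncomputable def selWeight {N : ℕ} (q : Fin N → ℝ) (S : Finset (Fin N)) : ℝ :=
  ((∏ i ∈ S, q i) * ∏ i ∈ Sᶜ, (1 - q i)) / (1 - ∏ i, (1 - q i))

/-- Scalar multiple of a kernel by an extended nonnegative real. -/
noncomputable def kSMul {X : Type*} [MeasurableSpace X] (c : ℝ≥0∞) (κ : Kernel X X) :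
    Kernel X X :=
  ⟨fun x => c • κ x, Measure.measurable_of_measurable_coe _ (fun s hs => by
    simp_rw [Measure.smul_apply, smul_eq_mul]
    exact (κ.measurable_coe hs).const_mul c)⟩

/-- The multiple random-scan kernel `P_q = Σ_{∅≠S⊆{1,…,N}} w_S(q) P_S`. -/
noncomputable def mrsKernel {X : Type*} [MeasurableSpace X] {N : ℕ}
    (P : Fin N → Kernel X X) (q : Fin N → ℝ) : Kernel X X :=
  ∑ S ∈ Finset.univ.filter (fun S : Finset (Fin N) => S.Nonempty),
    kSMul (ENNReal.ofReal (selWeight q S)) (subsetComp P S)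

/-- The single-coordinate random-scan kernel `P_p = Σ_{i=1}^N p_i P_i`. -/
noncomputable def rsKernel {X : Type*} [MeasurableSpace X] {N : ℕ}
    (P : Fin N → Kernel X X) (p : Fin N → ℝ) : Kernel X X :=
  ∑ i : Fin N, kSMul (ENNReal.ofReal (p i)) (P i)

/-- The Dobrushin contraction coefficient `β(P) = sup_{x,y} ‖P(x,·) − P(y,·)‖_TV`. -/
noncomputable def dobrushin {X : Type*} [MeasurableSpace X] (P : Kernel X X) : ℝ :=
  ⨆ x : X, ⨆ y : X, tvDist (P x) (P y)

/-- A kernel `P` with target probability measure `π` is uniformly ergodic if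
`sup_x ‖P^n(x,·) − π‖_TV ≤ M ρ^n` for some `M ≥ 0` and `ρ ∈ [0,1)` and all `n ≥ 1`. -/
def UniformlyErgodic {X : Type*} [MeasurableSpace X] (P : Kernel X X) (π : Measure X) : Prop :=
  ∃ M ρ : ℝ, 0 ≤ M ∧ 0 ≤ ρ ∧ ρ < 1 ∧
    ∀ n : ℕ, 1 ≤ n → ∀ x : X, tvDist (kpow P n x) π ≤ M * ρ ^ n

section KernelLemmas

variable {X : Type*} [MeasurableSpace X]

lemma tvDist_le_of_forall {μ ν : Measure X} {t : ℝ}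
    (h : ∀ A, MeasurableSet A → |μ.real A - ν.real A| ≤ t) : tvDist μ ν ≤ t :=
  have : Nonempty {s : Set X // MeasurableSet s} := ⟨⟨∅, .empty⟩⟩
  ciSup_le fun A => h A.1 A.2

lemma abs_real_sub_real_le_one (μ ν : Measure X) [IsProbabilityMeasure μ]
    [IsProbabilityMeasure ν] (A : Set X) : |μ.real A - ν.real A| ≤ 1 := by
  have h1 : μ.real A ≤ 1 := measureReal_le_one
  have h2 : ν.real A ≤ 1 := measureReal_le_one
  have h3 : 0 ≤ μ.real A := measureReal_nonneg
  have h4 : 0 ≤ ν.real A := measureReal_nonneg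
  rw [abs_le]
  constructor <;> linarith

lemma abs_real_sub_real_le_tvDist (μ ν : Measure X) [IsProbabilityMeasure μ]
    [IsProbabilityMeasure ν] {A : Set X} (hA : MeasurableSet A) :
    |μ.real A - ν.real A| ≤ tvDist μ ν := by
  refine le_ciSup (f := fun A : {s : Set X // MeasurableSet s} =>
    |(μ A.1).toReal - (ν A.1).toReal|) ⟨1, ?_⟩ ⟨A, hA⟩
  rintro _ ⟨B, rfl⟩
  exact abs_real_sub_real_le_one μ ν B.1

lemma integrable_of_mem_Icc (μ : Measure X) [IsFiniteMeasure μ] {f : X → ℝ} (hf : Measurable f)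
    {a b : ℝ} (h : ∀ x, f x ∈ Set.Icc a b) : Integrable f μ :=
  Integrable.of_mem_Icc a b hf.aemeasurable (ae_of_all _ h)

lemma integral_le_integral_add_of_measureReal_le (μ ν : Measure X) [IsProbabilityMeasure μ]
    [IsProbabilityMeasure ν] {t : ℝ}
    (h : ∀ A, MeasurableSet A → μ.real A ≤ ν.real A + t)
    {f : X → ℝ} (hf : Measurable f) {b : ℝ} (hfb : ∀ x, f x ∈ Set.Icc 0 b) (hb : 0 ≤ b) :
    ∫ x, f x ∂μ ≤ ∫ x, f x ∂ν + t * b := by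
  have layer (ξ : Measure X) [IsProbabilityMeasure ξ] :
      ∫ x, f x ∂ξ = ∫ s in Set.Ioc 0 b, ξ.real {x | s ≤ f x} :=
    (integrable_of_mem_Icc ξ hf hfb).integral_eq_integral_Ioc_meas_le
      (ae_of_all _ fun x => (hfb x).1) (ae_of_all _ fun x => (hfb x).2)
  have meas (ξ : Measure X) [IsProbabilityMeasure ξ] :
      IntegrableOn (fun s => ξ.real {x | s ≤ f x}) (Set.Ioc 0 b) := by
    refine Integrable.of_mem_Icc 0 1 (Antitone.measurable ?_).aemeasurable
      (ae_of_all _ fun s => ⟨measureReal_nonneg, measureReal_le_one⟩)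
    exact fun s s' hs => measureReal_mono fun x hx => hs.trans hx
  have const : ∫ _ in Set.Ioc 0 b, t = t * b := by
    simp [hb, mul_comm]
  have hc : IntegrableOn (fun _ : ℝ => t) (Set.Ioc 0 b) := integrableOn_const (by simp)
  rw [layer μ, layer ν, ← const, ← integral_add (meas ν) hc]
  exact setIntegral_mono (meas μ) ((meas ν).add hc)
    fun s => h _ (measurableSet_le measurable_const hf)

lemma measureReal_comp_apply (κ η : Kernel X X) [IsMarkovKernel κ] [IsMarkovKernel η]
    (x : X) {A : Set X} (hA : MeasurableSet A) :
    ((η ∘ₖ κ) x).real A = ∫ y, (η y).real A ∂(κ x) := by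
  simp only [Measure.real]
  rw [Kernel.comp_apply' _ _ _ hA, integral_toReal (η.measurable_coe hA).aemeasurable
    (ae_of_all _ fun y => measure_lt_top _ _)]

lemma measureReal_eq_integral_of_bind_eq {π : Measure X} {κ : Kernel X X} [IsMarkovKernel κ]
    (h : π.bind κ = π) {A : Set X} (hA : MeasurableSet A) :
    π.real A = ∫ y, (κ y).real A ∂π := by
  conv_lhs => rw [← h]
  simp only [Measure.real]
  rw [Measure.bind_apply hA κ.aemeasurable, integral_toReal (κ.measurable_coe hA).aemeasurable
    (ae_of_all _ fun y => measure_lt_top _ _)]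

instance kpow_isMarkovKernel (κ : Kernel X X) [IsMarkovKernel κ] (n : ℕ) :
    IsMarkovKernel (kpow κ n) := by
  induction n with
  | zero => exact inferInstanceAs (IsMarkovKernel Kernel.id)
  | succ n ih => exact inferInstanceAs (IsMarkovKernel (kpow κ n ∘ₖ κ))

lemma kpow_add (κ : Kernel X X) (m n : ℕ) : kpow κ (m + n) = kpow κ m ∘ₖ kpow κ n := by
  induction n with
  | zero => exact (Kernel.comp_id _).symm
  | succ n ih =>
    change kpow κ (m + n) ∘ₖ κ = kpow κ m ∘ₖ (kpow κ n ∘ₖ κ)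
    rw [ih, Kernel.comp_assoc]

lemma kpow_one (κ : Kernel X X) : kpow κ 1 = κ := Kernel.id_comp _

lemma bind_kpow {π : Measure X} {κ : Kernel X X} (h : π.bind κ = π) (n : ℕ) :
    π.bind (kpow κ n) = π := by
  induction n with
  | zero => exact Measure.id_comp
  | succ n ih =>
    change π.bind (kpow κ n ∘ₖ κ) = π
    rw [← Measure.comp_assoc, h, ih]

/-- `κ` minorizes `c • η` pointwise, as measures on measurable sets. -/
def Minorizes (κ : Kernel X X) (c : ℝ≥0∞) (η : Kernel X X) : Prop :=
  ∀ x, c • η x ≤ κ x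

lemma Minorizes.comp {κ η κ' η' : Kernel X X} {c c' : ℝ≥0∞}
    (h' : Minorizes κ' c' η') (h : Minorizes κ c η) :
    Minorizes (κ' ∘ₖ κ) (c' * c) (η' ∘ₖ η) := by
  intro x
  refine Measure.le_iff.2 fun A hA => ?_
  rw [Measure.smul_apply, Kernel.comp_apply' _ _ _ hA, Kernel.comp_apply' _ _ _ hA, smul_eq_mul]
  calc c' * c * ∫⁻ y, η' y A ∂(η x) = ∫⁻ y, c' * η' y A ∂(c • η x) := by
        rw [lintegral_smul_measure, lintegral_const_mul _ (η'.measurable_coe hA), smul_eq_mul]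
        ring
    _ ≤ ∫⁻ y, κ' y A ∂(κ x) := lintegral_mono' (h x) fun y => h' y A

lemma Minorizes.kpow {κ η : Kernel X X} {c : ℝ≥0∞} {n : ℕ}
    (h : Minorizes (kpow κ n) c η) (m : ℕ) :
    Minorizes (kpow κ (n * m)) (c ^ m) (kpow η m) := by
  induction m with
  | zero => exact fun x => by simp [_root_.kpow]
  | succ m ih =>
    rw [Nat.mul_succ, kpow_add, pow_succ]
    exact ih.comp h

lemma minorizes_foldl_comp {κ : Kernel X X} {c : ℝ≥0∞} (l : List (Kernel X X))
    (hl : ∀ η ∈ l, Minorizes κ c η) {acc : Kernel X X} {n : ℕ}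
    (hacc : Minorizes (kpow κ n) (c ^ n) acc) :
    Minorizes (kpow κ (l.length + n)) (c ^ (l.length + n))
      (l.foldl (fun acc η => η ∘ₖ acc) acc) := by
  induction l generalizing acc n with
  | nil => simpa using hacc
  | cons η l ih =>
    have hη : Minorizes (kpow κ (1 + n)) (c ^ (1 + n)) (η ∘ₖ acc) := by
      rw [kpow_add, kpow_one, pow_add, pow_one]
      exact (hl η (by simp)).comp hacc
    have := ih (fun ξ hξ => hl ξ (by simp [hξ])) hη
    rwa [← add_assoc] at this

lemma minorizes_seqComp {κ : Kernel X X} {c : ℝ≥0∞} (l : List (Kernel X X))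
    (hl : ∀ η ∈ l, Minorizes κ c η) :
    Minorizes (kpow κ l.length) (c ^ l.length) (seqComp l) :=
  minorizes_foldl_comp l hl (n := 0) fun x => by simp [kpow]

lemma isMarkovKernel_seqComp (l : List (Kernel X X)) (hl : ∀ η ∈ l, IsMarkovKernel η) :
    IsMarkovKernel (seqComp l) := by
  have key (l : List (Kernel X X)) (hl : ∀ η ∈ l, IsMarkovKernel η) (acc : Kernel X X)
      [IsMarkovKernel acc] : IsMarkovKernel (l.foldl (fun acc η => η ∘ₖ acc) acc) := by
    induction l generalizing acc with
    | nil => assumption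
    | cons η l ih =>
      have := hl η (by simp)
      exact ih (fun ξ hξ => hl ξ (by simp [hξ])) (η ∘ₖ acc)
  exact key l hl Kernel.id

lemma gsKernel_isMarkovKernel {N : ℕ} (P : Fin N → Kernel X X) (hP : ∀ i, IsMarkovKernel (P i)) :
    IsMarkovKernel (gsKernel P) := by
  refine isMarkovKernel_seqComp _ fun η hη => ?_
  obtain ⟨i, -, rfl⟩ := List.mem_map.1 hη
  exact hP i

lemma minorizes_gsKernel {N : ℕ} (P : Fin N → Kernel X X) {κ : Kernel X X} {c : ℝ≥0∞}
    (h : ∀ i, Minorizes κ c (P i)) : Minorizes (kpow κ N) (c ^ N) (gsKernel P) := by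
  have := minorizes_seqComp (κ := κ) (c := c)
    (((Finset.univ : Finset (Fin N)).sort (· ≤ ·)).map P) fun η hη => by
      obtain ⟨i, -, rfl⟩ := List.mem_map.1 hη
      exact h i
  simpa [gsKernel, subsetComp] using this

lemma rsKernel_apply {N : ℕ} (P : Fin N → Kernel X X) (p : Fin N → ℝ) (x : X) :
    rsKernel P p x = ∑ i, ENNReal.ofReal (p i) • P i x := by
  rw [rsKernel, _root_.sum_apply]
  rfl

lemma sum_ofReal_eq_one {N : ℕ} {p : Fin N → ℝ} (hp : ∀ i, 0 ≤ p i) (hsum : ∑ i, p i = 1) :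
    ∑ i, ENNReal.ofReal (p i) = 1 := by
  rw [← ENNReal.ofReal_sum_of_nonneg fun i _ => hp i, hsum, ENNReal.ofReal_one]

lemma rsKernel_isMarkovKernel {N : ℕ} (P : Fin N → Kernel X X) (hP : ∀ i, IsMarkovKernel (P i))
    {p : Fin N → ℝ} (hp : ∀ i, 0 ≤ p i) (hsum : ∑ i, p i = 1) :
    IsMarkovKernel (rsKernel P p) :=
  ⟨fun x => ⟨by simp [rsKernel_apply, sum_ofReal_eq_one hp hsum]⟩⟩

lemma bind_rsKernel {N : ℕ} (P : Fin N → Kernel X X) {π : Measure X}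
    (hinv : ∀ i, π.bind (P i) = π) {p : Fin N → ℝ} (hp : ∀ i, 0 ≤ p i) (hsum : ∑ i, p i = 1) :
    π.bind (rsKernel P p) = π := by
  refine Measure.ext fun A hA => ?_
  rw [Measure.bind_apply hA (Kernel.aemeasurable _)]
  simp only [rsKernel_apply, Measure.finsetSum_apply, Measure.smul_apply, smul_eq_mul]
  rw [lintegral_finsetSum _ fun i _ => ((P i).measurable_coe hA).const_mul _]
  have (i : Fin N) : ∫⁻ x, ENNReal.ofReal (p i) * P i x A ∂π = ENNReal.ofReal (p i) * π A := by
    rw [lintegral_const_mul _ ((P i).measurable_coe hA),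
      ← Measure.bind_apply hA (Kernel.aemeasurable _), hinv i]
  simp only [this]
  rw [← Finset.sum_mul, sum_ofReal_eq_one hp hsum, one_mul]

lemma minorizes_rsKernel {N : ℕ} (P : Fin N → Kernel X X) {p : Fin N → ℝ} {ε : ℝ}
    (hp : ∀ i, ε ≤ p i) (i : Fin N) : Minorizes (rsKernel P p) (ENNReal.ofReal ε) (P i) := by
  intro x
  refine Measure.le_iff.2 fun A _ => ?_
  rw [rsKernel_apply, Measure.finsetSum_apply, Measure.smul_apply, smul_eq_mul]
  calc ENNReal.ofReal ε * P i x A ≤ ENNReal.ofReal (p i) * P i x A := by gcongr; exact hp i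
    _ ≤ _ := Finset.single_le_sum (f := fun j => (ENNReal.ofReal (p j) • P j x) A)
      (fun _ _ => zero_le) (Finset.mem_univ i)

lemma Minorizes.mul_integral_le {κ η : Kernel X X} [IsMarkovKernel κ] {c : ℝ} (hc : 0 ≤ c)
    (h : Minorizes κ (ENNReal.ofReal c) η) (x : X) {f : X → ℝ} (hf0 : ∀ y, 0 ≤ f y)
    (hf : Integrable f (κ x)) : c * ∫ y, f y ∂(η x) ≤ ∫ y, f y ∂(κ x) := by
  have := integral_mono_measure (h x) (ae_of_all _ hf0) hf
  rwa [integral_smul_measure, ENNReal.toReal_ofReal hc, smul_eq_mul] at this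

/-- One-sided contraction: a function on `[0, 2 D]` with `π`-mean `D` has `κ`-means at least
`(c / 2) * D` when `κ` minorizes `c • η` and `η` is within `1 / 4` of `π`. -/
lemma Minorizes.half_mul_le_integral {κ η : Kernel X X} [IsMarkovKernel κ] [IsMarkovKernel η]
    {π : Measure X} [IsProbabilityMeasure π] {c : ℝ} (hc : 0 ≤ c)
    (h : Minorizes κ (ENNReal.ofReal c) η) (hη : ∀ x, tvDist (η x) π ≤ 1 / 4)
    (x : X) {f : X → ℝ} (hf : Measurable f) {D : ℝ} (hD : 0 ≤ D)
    (hfD : ∀ y, f y ∈ Set.Icc 0 (2 * D)) (hfπ : ∫ y, f y ∂π = D) :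
    c / 2 * D ≤ ∫ y, f y ∂(κ x) := by
  have h1 := h.mul_integral_le hc x (fun y => (hfD y).1) (integrable_of_mem_Icc _ hf hfD)
  have h2 := integral_le_integral_add_of_measureReal_le π (η x) (t := 1 / 4)
    (fun A hA => by
      have := (abs_le.1 ((abs_real_sub_real_le_tvDist (η x) π hA).trans (hη x))).1
      linarith) hf hfD (by linarith)
  rw [hfπ] at h2
  nlinarith

lemma Minorizes.abs_integral_sub_le {κ η : Kernel X X} [IsMarkovKernel κ] [IsMarkovKernel η]
    {π : Measure X} [IsProbabilityMeasure π] {c : ℝ} (hc : 0 ≤ c)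
    (h : Minorizes κ (ENNReal.ofReal c) η) (hη : ∀ x, tvDist (η x) π ≤ 1 / 4)
    (x : X) {f : X → ℝ} (hf : Measurable f) {D : ℝ} (hD : 0 ≤ D)
    (hfD : ∀ y, |f y - ∫ z, f z ∂π| ≤ D) :
    |∫ y, f y ∂(κ x) - ∫ z, f z ∂π| ≤ (1 - c / 2) * D := by
  set m := ∫ z, f z ∂π with hm
  have int (ξ : Measure X) [IsProbabilityMeasure ξ] : Integrable f ξ :=
    integrable_of_mem_Icc (a := m - D) (b := m + D) ξ hf fun y => by
      obtain ⟨h1, h2⟩ := abs_le.1 (hfD y)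
      constructor <;> linarith
  have up (ξ : Measure X) [IsProbabilityMeasure ξ] :
      ∫ y, (f y - (m - D)) ∂ξ = ∫ y, f y ∂ξ - (m - D) := by
    rw [integral_sub (int ξ) (integrable_const _)]; simp
  have down (ξ : Measure X) [IsProbabilityMeasure ξ] :
      ∫ y, (m + D - f y) ∂ξ = m + D - ∫ y, f y ∂ξ := by
    rw [integral_sub (integrable_const _) (int ξ)]; simp
  have h1 := h.half_mul_le_integral hc hη x (hf.sub_const (m - D)) hD (fun y => by
    obtain ⟨h1, h2⟩ := abs_le.1 (hfD y)
    constructor <;> linarith) (by rw [up, ← hm]; ring)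
  have h2 := h.half_mul_le_integral hc hη x (hf.const_sub (m + D)) hD (fun y => by
    obtain ⟨h1, h2⟩ := abs_le.1 (hfD y)
    constructor <;> linarith) (by rw [down, ← hm]; ring)
  rw [up] at h1
  rw [down] at h2
  rw [abs_le]
  constructor <;> linarith

lemma abs_integral_sub_le_of_forall (μ : Measure X) [IsProbabilityMeasure μ] {f : X → ℝ}
    (hf : Measurable f) {m D : ℝ} (h : ∀ y, |f y - m| ≤ D) : |∫ y, f y ∂μ - m| ≤ D := by
  have int : Integrable f μ := integrable_of_mem_Icc (a := m - D) (b := m + D) μ hf fun y => by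
    obtain ⟨h1, h2⟩ := abs_le.1 (h y)
    constructor <;> linarith
  have : ∫ y, f y ∂μ - m = ∫ y, (f y - m) ∂μ := by
    rw [integral_sub int (integrable_const _)]; simp
  rw [this]
  simpa using norm_integral_le_of_norm_le_const (μ := μ) (f := fun y => f y - m) (C := D)
    (ae_of_all _ h)

lemma Minorizes.abs_kpow_sub_le {κ η : Kernel X X} [IsMarkovKernel κ] [IsMarkovKernel η]
    {π : Measure X} [IsProbabilityMeasure π] (hinv : π.bind κ = π) {c : ℝ} (hc : 0 ≤ c)
    (hc1 : c ≤ 1) {n : ℕ} (h : Minorizes (_root_.kpow κ n) (ENNReal.ofReal c) η)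
    (hη : ∀ x, tvDist (η x) π ≤ 1 / 4) {A : Set X} (hA : MeasurableSet A) (k j : ℕ) (x : X) :
    |(_root_.kpow κ (n * k + j) x).real A - π.real A| ≤ (1 - c / 2) ^ k := by
  have meas (i : ℕ) : Measurable fun y => (_root_.kpow κ i y).real A :=
    ((_root_.kpow κ i).measurable_coe hA).ennreal_toReal
  have mean (i : ℕ) := measureReal_eq_integral_of_bind_eq (bind_kpow hinv i) hA
  have key (k : ℕ) (x : X) :
      |(_root_.kpow κ (n * k) x).real A - π.real A| ≤ (1 - c / 2) ^ k := by
    induction k generalizing x with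
    | zero => simpa using abs_real_sub_real_le_one _ _ A
    | succ k ih =>
      rw [Nat.mul_succ, kpow_add, measureReal_comp_apply _ _ x hA, mean (n * k), pow_succ']
      refine h.abs_integral_sub_le hc hη x (meas _) (by apply pow_nonneg; linarith) fun y => ?_
      rw [← mean]
      exact ih y
  rw [kpow_add, measureReal_comp_apply _ _ x hA]
  exact abs_integral_sub_le_of_forall _ (meas _) (key k)

lemma pow_div_le_inv_mul_rpow_pow {r : ℝ} (hr : 0 < r) (hr1 : r ≤ 1) {n : ℕ} (hn : 0 < n)
    (j : ℕ) : r ^ (j / n) ≤ r⁻¹ * (r ^ ((n : ℝ)⁻¹)) ^ j := by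
  have hn' : (0 : ℝ) < n := by exact_mod_cast hn
  rw [← Real.rpow_natCast r, ← Real.rpow_natCast (r ^ _), ← Real.rpow_mul hr.le,
    ← Real.rpow_neg_one, ← Real.rpow_add hr]
  refine Real.rpow_le_rpow_of_exponent_ge hr hr1 ?_
  have h1 : j < n * (j / n + 1) := Nat.lt_mul_div_succ j hn
  have h2 : (j : ℝ) ≤ n * ((j / n : ℕ) + 1) := by exact_mod_cast h1.le
  have h3 : (n : ℝ)⁻¹ * j ≤ (j / n : ℕ) + 1 := by
    rw [inv_mul_le_iff₀ hn']
    exact h2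
  linarith

/-- If a power of `κ` minorizes a multiple of a kernel uniformly close to the invariant
distribution of `κ`, then `κ` is uniformly ergodic. -/
lemma Minorizes.uniformlyErgodic {κ η : Kernel X X} [IsMarkovKernel κ] [IsMarkovKernel η]
    {π : Measure X} [IsProbabilityMeasure π] (hinv : π.bind κ = π) {c : ℝ} (hc : 0 < c)
    (hc1 : c ≤ 1) {n : ℕ} (hn : 0 < n) (h : Minorizes (_root_.kpow κ n) (ENNReal.ofReal c) η)
    (hη : ∀ x, tvDist (η x) π ≤ 1 / 4) : UniformlyErgodic κ π := by
  have hr : 0 < 1 - c / 2 := by linarith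
  refine ⟨(1 - c / 2)⁻¹, (1 - c / 2) ^ ((n : ℝ)⁻¹), by positivity, by positivity,
    Real.rpow_lt_one hr.le (by linarith) (by positivity), fun j _ x => ?_⟩
  refine tvDist_le_of_forall fun A hA => ?_
  have := h.abs_kpow_sub_le hinv hc.le hc1 hη hA (j / n) (j % n) x
  rw [Nat.div_add_mod] at this
  exact this.trans (pow_div_le_inv_mul_rpow_pow hr (by linarith) hn j)

lemma UniformlyErgodic.exists_tvDist_kpow_le {κ : Kernel X X} {π : Measure X}
    (h : UniformlyErgodic κ π) {t : ℝ} (ht : 0 < t) :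
    ∃ m, 1 ≤ m ∧ ∀ x, tvDist (kpow κ m x) π ≤ t := by
  obtain ⟨M, ρ, -, hρ, hρ1, hb⟩ := h
  have hlim : Tendsto (fun n => M * ρ ^ n) atTop (nhds 0) := by
    simpa using (tendsto_pow_atTop_nhds_zero_of_lt_one hρ hρ1).const_mul M
  obtain ⟨m, hm, hm1⟩ := ((hlim.eventually (ge_mem_nhds ht)).and (eventually_ge_atTop 1)).exists
  exact ⟨m, hm1, fun x => (hb m hm1 x).trans hm⟩

end KernelLemmas

/-- If each `P_i` leaves `π` invariant and the systematic-scan kernel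
is uniformly ergodic with invariant distribution `π`, then for `ε > 0` and
`p ∈ [ε,1]^N` with `Σ_i p_i = 1`, the single-coordinate random-scan kernel
`P_p = Σ_i p_i P_i` is uniformly ergodic with invariant distribution `π`. -/
theorem rsg_uniformly_ergodic
    {X : Type*} [MeasurableSpace X] {N : ℕ}
    (P : Fin N → Kernel X X) (hP : ∀ i, IsMarkovKernel (P i))
    (π : Measure X) [IsProbabilityMeasure π]
    (hinv : ∀ i, π.bind (P i) = π)
    (hGSinv : π.bind (gsKernel P) = π)
    (hGS : UniformlyErgodic (gsKernel P) π)
    (ε : ℝ) (hε : 0 < ε) (p : Fin N → ℝ)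
    (hp : ∀ i, ε ≤ p i ∧ p i ≤ 1) (hsum : ∑ i, p i = 1) :
    π.bind (rsKernel P p) = π ∧ UniformlyErgodic (rsKernel P p) π := by
  have hp0 (i : Fin N) : 0 ≤ p i := hε.le.trans (hp i).1
  have hbind := bind_rsKernel P hinv hp0 hsum
  refine ⟨hbind, ?_⟩
  have hN : 0 < N := by
    rcases Nat.eq_zero_or_pos N with rfl | hN
    · simp at hsum
    · exact hN
  have hε1 : ε ≤ 1 := (hp ⟨0, hN⟩).1.trans (hp ⟨0, hN⟩).2
  have := gsKernel_isMarkovKernel P hP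
  have := rsKernel_isMarkovKernel P hP hp0 hsum
  obtain ⟨m, hm, hclose⟩ := hGS.exists_tvDist_kpow_le (t := 1 / 4) (by norm_num)
  have hmin := (minorizes_gsKernel P (minorizes_rsKernel P fun i => (hp i).1)).kpow m
  rw [← ENNReal.ofReal_pow hε.le, ← ENNReal.ofReal_pow (by positivity)] at hmin
  exact hmin.uniformlyErgodic hbind (by positivity)
    (pow_le_one₀ (by positivity) (pow_le_one₀ hε.le hε1)) (Nat.mul_pos hN hm) hclose
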